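/- Assume Σ_{t=0}^{∞} t · vol Y^t < ∞. Then there exist measures μ₀ ∈ M₊(X⁰) and ν ∈ M₊(X) such that the restriction of the Lebesgue measure to the reachable set X^∞ solves the discrete Liouville equation λ_{X^∞} + ν = f_#ν + μ₀ as an equality of measures on ℝ^n. -/

import Mathlib

open MeasureTheory
open scoped ENNReal

/-- A continuous map from the Cantor set has a Borel measurable section over its range: send a
point to the least element of its fiber. -/
theorem exists_measurable_section_of_cantorSet {F : Type*} [TopologicalSpace F] [T2Space F]
    [MeasurableSpace F] [BorelSpace F] {k : cantorSet → F} (hk : Continuous k) :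
    ∃ m : F → cantorSet, Measurable m ∧ ∀ y ∈ Set.range k, k (m y) = y := by
  classical
  have : CompactSpace cantorSet := isCompact_iff_compactSpace.mp isCompact_cantorSet
  have least : ∀ y ∈ Set.range k, ∃ c, k c = y ∧ ∀ d, k d = y → (c : ℝ) ≤ d := by
    rintro y ⟨c₀, hc₀⟩
    have hcpt : IsCompact (k ⁻¹' {y}) := (isClosed_singleton.preimage hk).isCompact
    obtain ⟨c, hc, hmin⟩ := hcpt.exists_isMinOn ⟨c₀, hc₀⟩ continuous_subtype_val.continuousOn
    exact ⟨c, hc, fun d hd => hmin hd⟩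
  choose! m hm hmin using fun y : Set.range k => least y y.2
  have hrange : MeasurableSet (Set.range k) := (isCompact_range hk).measurableSet
  have hmeas : Measurable m := by
    refine Measurable.subtype_mk (f := fun y => (m y : ℝ)) (measurable_of_Iic fun a => ?_)
    have hclosed : MeasurableSet (k '' {c | (c : ℝ) ≤ a}) :=
      ((isClosed_le continuous_subtype_val continuous_const).isCompact.image hk).measurableSet
    convert measurable_subtype_coe hclosed using 1
    ext y
    constructor
    · exact fun h => ⟨m y, h, hm y⟩
    · rintro ⟨c, hc, hcy⟩
      exact (hmin y c hcy).trans hc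
  refine ⟨fun y => if hy : y ∈ Set.range k then m ⟨y, hy⟩ else ⟨0, zero_mem_cantorSet⟩,
    Measurable.dite hmeas measurable_const hrange, fun y hy => ?_⟩
  simp only [dif_pos hy]
  exact hm ⟨y, hy⟩

/-- A continuous map on a compact subset of a metric space has a Borel measurable section over its
image. -/
theorem IsCompact.exists_measurable_section {E F : Type*} [MetricSpace E] [Nonempty E]
    [MeasurableSpace E] [BorelSpace E] [TopologicalSpace F] [T2Space F] [MeasurableSpace F]
    [BorelSpace F] {K : Set E} (hK : IsCompact K) {g : E → F} (hg : ContinuousOn g K) :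
    ∃ s : F → E, Measurable s ∧ ∀ y ∈ g '' K, s y ∈ K ∧ g (s y) = y := by
  rcases K.eq_empty_or_nonempty with rfl | hne
  · exact ⟨fun _ => Classical.arbitrary E, measurable_const, by simp⟩
  have : CompactSpace K := isCompact_iff_compactSpace.mp hK
  have : Nonempty K := hne.to_subtype
  obtain ⟨q, hq, hqs⟩ := exists_nat_bool_continuous_surjective_of_compact K
  have hp : Continuous (q ∘ cantorSetHomeomorphNatToBool) :=
    hq.comp cantorSetHomeomorphNatToBool.continuous
  obtain ⟨m, hm, hmk⟩ := exists_measurable_section_of_cantorSet (hg.domRestrict.comp hp)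
  refine ⟨fun y => (q (cantorSetHomeomorphNatToBool (m y)) : E),
    measurable_subtype_coe.comp (hp.measurable.comp hm), ?_⟩
  rintro y ⟨x, hx, rfl⟩
  refine ⟨Subtype.coe_prop _, hmk _ ?_⟩
  obtain ⟨b, hb⟩ := hqs ⟨x, hx⟩
  exact ⟨cantorSetHomeomorphNatToBool.symm b, by simp [hb]⟩

/-- A measure concentrated on the image of a compact set under a continuous map lifts to a measure
concentrated on that compact set. -/
theorem IsCompact.exists_measure_map_eq {E F : Type*} [MetricSpace E] [Nonempty E]
    [MeasurableSpace E] [BorelSpace E] [TopologicalSpace F] [T2Space F] [MeasurableSpace F]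
    [BorelSpace F] {K : Set E} (hK : IsCompact K) {g : E → F} (hg : Continuous g)
    {μ : Measure F} (hμ : ∀ᵐ y ∂μ, y ∈ g '' K) :
    ∃ σ : Measure E, σ Kᶜ = 0 ∧ σ.map g = μ := by
  obtain ⟨s, hs, hsec⟩ := hK.exists_measurable_section hg.continuousOn
  refine ⟨μ.map s, ?_, ?_⟩
  · rw [Measure.map_apply hs hK.measurableSet.compl, Set.preimage_compl, ← mem_ae_iff]
    exact hμ.mono fun y hy => (hsec y hy).1
  · rw [Measure.map_map hg.measurable hs, Measure.map_congr (g := id), Measure.map_id]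
    exact hμ.mono fun y hy => (hsec y hy).2

/-- For measures `σ t`, the occupation measure `∑ t, ∑ s < t, f^[s]_# σ t` solves the discrete
Liouville equation with initial measure `∑ t, σ t` and terminal measure `∑ t, f^[t]_# σ t`. -/
theorem sum_map_iterate_add_occupation {E : Type*} [MeasurableSpace E] {f : E → E}
    (hf : Measurable f) (σ : ℕ → Measure E) :
    (Measure.sum fun t => (σ t).map f^[t]) +
        (Measure.sum fun t => ∑ s ∈ Finset.range t, (σ t).map f^[s]) =
      Measure.map f (Measure.sum fun t => ∑ s ∈ Finset.range t, (σ t).map f^[s]) +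
        Measure.sum σ := by
  ext A hA
  rw [Measure.add_apply, Measure.add_apply, Measure.map_apply hf hA, Measure.sum_apply _ hA,
    Measure.sum_apply _ hA, Measure.sum_apply _ hA, Measure.sum_apply _ (hf hA),
    ← ENNReal.tsum_add, ← ENNReal.tsum_add]
  refine tsum_congr fun t => ?_
  have hshift : ∀ s, (σ t).map f^[s] (f ⁻¹' A) = (σ t).map f^[s + 1] A := fun s => by
    rw [Measure.map_apply (hf.iterate s) (hf hA), Measure.map_apply (hf.iterate _) hA,
      Function.iterate_succ', Set.preimage_comp]
  simp only [Measure.finsetSum_apply, hshift]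
  rw [add_comm, ← Finset.sum_range_succ (fun s => (σ t).map f^[s] A),
    Finset.sum_range_succ' (fun s => (σ t).map f^[s] A), Function.iterate_zero, Measure.map_id]

/-- If `∑_{t=0}^{∞} t · vol Y^t < ∞`, then there exist `μ₀ ∈ M₊(X⁰)` and `ν ∈ M₊(X)`
such that the restriction of the Lebesgue measure to the reachable set `X^∞` solves
the discrete Liouville equation `λ_{X^∞} + ν = f_# ν + μ₀`. -/
theorem liouville_infinite_horizon (n : ℕ) (hn : 1 ≤ n)
    (f : (Fin n → ℝ) → (Fin n → ℝ))
    (hfpoly : ∀ i, ∃ p : MvPolynomial (Fin n) ℝ, ∀ x, f x i = MvPolynomial.eval x p)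
    (X0 X : Set (Fin n → ℝ)) (hX0 : IsCompact X0) (hX : IsCompact X)
    (hreach : (⋃ t : ℕ, f^[t] '' X0) ⊆ X)
    (Y : ℕ → Set (Fin n → ℝ))
    (hY0 : Y 0 = X0)
    (hYt : ∀ t : ℕ, 1 ≤ t → Y t = f^[t] '' X0 \ ⋃ s ∈ Finset.range t, f^[s] '' X0)
    (hsum : (∑' t : ℕ, (t : ℝ≥0∞) * volume (Y t)) < ⊤) :
    ∃ μ₀ ν : Measure (Fin n → ℝ),
      IsFiniteMeasure μ₀ ∧ IsFiniteMeasure ν ∧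
      μ₀ X0ᶜ = 0 ∧ ν Xᶜ = 0 ∧
      volume.restrict (⋃ t : ℕ, f^[t] '' X0) + ν = Measure.map f ν + μ₀ := by
  have hf : Continuous f := continuous_pi fun i => by
    obtain ⟨p, hp⟩ := hfpoly i
    simpa only [hp] using p.continuous_eval
  have himg : ∀ t, IsCompact (f^[t] '' X0) := fun t => hX0.image (hf.iterate t)
  have hY : Y = disjointed fun t => f^[t] '' X0 := by
    funext t
    rcases t.eq_zero_or_pos with rfl | ht
    · simp [hY0]
    · rw [hYt t ht, disjointed_apply, Finset.sup_set_eq_biUnion]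
      simp [Finset.mem_Iio]
  have hYsub : ∀ t, Y t ⊆ f^[t] '' X0 := fun t => hY ▸ disjointed_subset _ t
  have hYmeas : ∀ t, MeasurableSet (Y t) := fun t =>
    hY ▸ MeasurableSet.disjointed (fun s => (himg s).measurableSet) t
  have hdecomp : volume.restrict (⋃ t, f^[t] '' X0) =
      Measure.sum fun t => volume.restrict (Y t) := by
    rw [← iUnion_disjointed, ← hY]
    exact Measure.restrict_iUnion (hY ▸ disjoint_disjointed _) hYmeas
  choose σ hσ hσmap using fun t => hX0.exists_measure_map_eq (hf.iterate t)
    (μ := volume.restrict (Y t))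
    ((ae_restrict_mem (hYmeas t)).mono fun y hy => hYsub t hy)
  have hmass : ∀ t s, (σ t).map f^[s] Set.univ = volume (Y t) := fun t s => by
    rw [Measure.map_apply (hf.iterate s).measurable .univ, Set.preimage_univ,
      ← Measure.restrict_apply_univ (Y t), ← hσmap t,
      Measure.map_apply (hf.iterate t).measurable .univ, Set.preimage_univ]
  refine ⟨Measure.sum σ, Measure.sum fun t => ∑ s ∈ Finset.range t, (σ t).map f^[s],
    ⟨?_⟩, ⟨?_⟩, ?_, ?_, ?_⟩
  · have hσmass : ∀ t, σ t Set.univ = volume.restrict (Y t) Set.univ := fun t => by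
      simpa using hmass t 0
    rw [Measure.sum_apply _ .univ, tsum_congr hσmass, ← Measure.sum_apply _ .univ, ← hdecomp,
      Measure.restrict_apply_univ]
    exact (measure_mono hreach).trans_lt hX.measure_lt_top
  · simpa [Measure.sum_apply _ MeasurableSet.univ, Measure.finsetSum_apply, hmass] using hsum
  · simp [Measure.sum_apply _ hX0.measurableSet.compl, hσ]
  · rw [Measure.sum_apply _ hX.measurableSet.compl, ENNReal.tsum_eq_zero]
    intro t
    rw [Measure.finsetSum_apply]
    refine Finset.sum_eq_zero fun s _ => ?_
    rw [Measure.map_apply (hf.iterate s).measurable hX.measurableSet.compl]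
    exact measure_mono_null
      (fun x hx hx0 => hx (hreach (Set.mem_iUnion.mpr ⟨s, x, hx0, rfl⟩))) (hσ t)
  · rw [hdecomp, ← sum_map_iterate_add_occupation hf.measurable, funext hσmap]
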